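/- If φ : S_n → S_n is linear with φ(C_n) = C_n, then φ maps the set T_n of symmetric nonnegative matrices with zero diagonal into itself: φ(T_n) ⊆ T_n. -/

import Mathlib

open Matrix

/-- A matrix is copositive if its quadratic form is nonnegative on the nonnegative orthant. -/
def Copositive {m : Type*} [Fintype m] (a : Matrix m m ℝ) : Prop :=
  ∀ u : m → ℝ, (∀ i, 0 ≤ u i) → 0 ≤ u ⬝ᵥ a *ᵥ u

/-- The submodule of symmetric n×n real matrices. -/
def Sn (n : ℕ) : Submodule ℝ (Matrix (Fin n) (Fin n) ℝ) where
  carrier := {a | a.IsSymm}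
  add_mem' := fun ha hb => ha.add hb
  zero_mem' := Matrix.isSymm_zero
  smul_mem' := fun c a ha => ha.smul c

/-- The copositive cone, as a subset of the symmetric matrices. -/
def Cn (n : ℕ) : Set (Sn n) := {a | Copositive a.1}

/-- The set A^t : symmetric matrices with (t,t) entry zero, all other entries positive. -/
def At (n : ℕ) (t : Fin n) : Set (Sn n) :=
  {a | a.1 t t = 0 ∧ ∀ i j, (i, j) ≠ (t, t) → 0 < a.1 i j}

/-- T_n : symmetric nonnegative matrices with zero diagonal. -/
def Tn (n : ℕ) : Set (Sn n) := {a | (∀ i j, 0 ≤ a.1 i j) ∧ ∀ i, a.1 i i = 0}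

/-- A monomial matrix: exactly one nonzero entry in each row and column. -/
def IsMonomial {n : ℕ} (m : Matrix (Fin n) (Fin n) ℝ) : Prop :=
  (∀ i, ∃! j, m i j ≠ 0) ∧ (∀ j, ∃! i, m i j ≠ 0)

section Copositivity

variable {m : Type*} [Fintype m]

theorem copositive_of_nonneg {a : Matrix m m ℝ} (ha : ∀ i j, 0 ≤ a i j) : Copositive a := by
  intro u hu
  simp only [dotProduct, mulVec]
  exact Finset.sum_nonneg fun i _ => mul_nonneg (hu i)
    (Finset.sum_nonneg fun j _ => mul_nonneg (ha i j) (hu j))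

/-- A form that is positive on the nonzero vectors of the orthant stays copositive after a small
perturbation. -/
theorem exists_copositive_sub_smul {a : Matrix m m ℝ}
    (ha : ∀ u : m → ℝ, (∀ i, 0 ≤ u i) → u ≠ 0 → 0 < u ⬝ᵥ a *ᵥ u) (x : Matrix m m ℝ) :
    ∃ ε : ℝ, 0 < ε ∧ Copositive (a - ε • x) := by
  have hcont : ∀ b : Matrix m m ℝ, Continuous fun u : m → ℝ => u ⬝ᵥ b *ᵥ u := fun b => by
    simp only [dotProduct, mulVec]
    fun_prop
  have hne : ∀ u ∈ stdSimplex ℝ m, u ≠ 0 := by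
    rintro u hu rfl
    simpa using hu.2
  have hK := isCompact_stdSimplex ℝ m
  obtain ⟨ε, hε, hle⟩ : ∃ ε : ℝ, 0 < ε ∧
      ∀ u ∈ stdSimplex ℝ m, ε * (u ⬝ᵥ x *ᵥ u) ≤ u ⬝ᵥ a *ᵥ u := by
    rcases (stdSimplex ℝ m).eq_empty_or_nonempty with he | hn
    · exact ⟨1, one_pos, by simp [he]⟩
    obtain ⟨v, hv, hmin⟩ := hK.exists_isMinOn hn (hcont a).continuousOn
    obtain ⟨w, hw, hmax⟩ := hK.exists_isMaxOn hn (hcont x).continuousOn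
    have hpos := ha v hv.1 (hne v hv)
    have hM : 0 < |w ⬝ᵥ x *ᵥ w| + 1 := by positivity
    refine ⟨(v ⬝ᵥ a *ᵥ v) / (|w ⬝ᵥ x *ᵥ w| + 1), by positivity, fun u hu => ?_⟩
    have h1 : v ⬝ᵥ a *ᵥ v ≤ u ⬝ᵥ a *ᵥ u := hmin hu
    have h2 : u ⬝ᵥ x *ᵥ u ≤ w ⬝ᵥ x *ᵥ w := hmax hu
    have h3 := le_abs_self (w ⬝ᵥ x *ᵥ w)
    refine le_trans ?_ h1
    rw [div_mul_eq_mul_div, div_le_iff₀ hM]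
    exact mul_le_mul_of_nonneg_left (by linarith) hpos.le
  refine ⟨ε, hε, fun u hu => ?_⟩
  by_cases hu0 : u = 0
  · simp [hu0]
  have hsum : 0 < ∑ i, u i := by
    refine lt_of_le_of_ne (Finset.sum_nonneg fun i _ => hu i) fun h => hu0 ?_
    ext i
    exact (Finset.sum_eq_zero_iff_of_nonneg fun i _ => hu i).1 h.symm i (Finset.mem_univ i)
  have h := hle ((∑ i, u i)⁻¹ • u) ⟨fun i => mul_nonneg (inv_nonneg.2 hsum.le) (hu i), by
    simp only [Pi.smul_apply, smul_eq_mul, ← Finset.mul_sum]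
    exact inv_mul_cancel₀ hsum.ne'⟩
  simp only [mulVec_smul, smul_dotProduct, dotProduct_smul, smul_eq_mul] at h
  have hinv : 0 < (∑ i, u i)⁻¹ := inv_pos.2 hsum
  have h' : ε * (u ⬝ᵥ x *ᵥ u) ≤ u ⬝ᵥ a *ᵥ u := by
    refine le_of_mul_le_mul_left ?_ (mul_pos hinv hinv)
    linarith
  rw [sub_mulVec, dotProduct_sub, smul_mulVec, dotProduct_smul, smul_eq_mul]
  linarith

variable [DecidableEq m]

theorem Copositive.diag_nonneg {a : Matrix m m ℝ} (ha : Copositive a) (i : m) : 0 ≤ a i i := by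
  have h := ha (Pi.single i 1) fun j => by
    by_cases hj : j = i
    · subst hj; simp
    · simp [hj]
  simpa using h

theorem dotProduct_mulVec_add_single {a : Matrix m m ℝ} (hs : a.IsSymm) (u : m → ℝ) (j : m)
    (t : ℝ) :
    (u + Pi.single j t) ⬝ᵥ a *ᵥ (u + Pi.single j t) =
      u ⬝ᵥ a *ᵥ u + 2 * t * (a *ᵥ u) j + t ^ 2 * a j j := by
  have h : u ⬝ᵥ a *ᵥ Pi.single j t = t * (a *ᵥ u) j := by
    rw [dotProduct_mulVec, ← mulVec_transpose, hs.eq, dotProduct_single, mul_comm]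
  rw [mulVec_add, add_dotProduct, dotProduct_add, dotProduct_add, h, single_dotProduct,
    single_dotProduct]
  have h' : (a *ᵥ Pi.single j t) j = a j j * t := by simp [mulVec_single]
  rw [h']
  ring

theorem Copositive.apply_nonneg {a : Matrix m m ℝ} (ha : Copositive a) (hs : a.IsSymm)
    (hd : ∀ i, a i i = 0) (i j : m) : 0 ≤ a i j := by
  have hsingle : ∀ k l : m, 0 ≤ (Pi.single k 1 : m → ℝ) l := fun k l => by
    by_cases hl : l = k
    · subst hl; simp
    · simp [hl]
  have h := ha (Pi.single j 1 + Pi.single i 1) fun k => add_nonneg (hsingle j k) (hsingle i k)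
  rw [dotProduct_mulVec_add_single hs] at h
  simp [hd] at h
  exact h

/-- A zero of a copositive form is a critical point in the directions of its support. -/
theorem Copositive.mulVec_apply_eq_zero {a : Matrix m m ℝ} (ha : Copositive a) (hs : a.IsSymm)
    {u : m → ℝ} (hu : ∀ i, 0 ≤ u i) (h0 : u ⬝ᵥ a *ᵥ u = 0) {j : m} (hj : 0 < u j) :
    (a *ᵥ u) j = 0 := by
  have key : ∀ t, -u j ≤ t → 0 ≤ 2 * t * (a *ᵥ u) j + t ^ 2 * a j j := by
    intro t ht
    have h := ha (u + Pi.single j t) fun k => by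
      by_cases hk : k = j
      · subst hk; simp; linarith
      · simp [hk, hu k]
    rw [dotProduct_mulVec_add_single hs, h0] at h
    linarith
  have hd := ha.diag_nonneg j
  set l := (a *ᵥ u) j
  set d := a j j
  have hsmall : ∀ s, 0 < s → s ≤ u j → |l| ≤ s * (d / 2) := by
    intro s hs0 hsu
    have h1 := key s (by linarith)
    have h2 := key (-s) (by linarith)
    rw [abs_le]
    constructor <;> refine le_of_mul_le_mul_left ?_ hs0 <;> nlinarith
  by_contra hl
  have hl' : 0 < |l| := abs_pos.mpr hl
  have h := hsmall (min (u j) (|l| / (d + 1))) (by positivity) (min_le_left _ _)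
  have h' : min (u j) (|l| / (d + 1)) * (d / 2) ≤ |l| / (d + 1) * (d / 2) :=
    mul_le_mul_of_nonneg_right (min_le_right _ _) (by positivity)
  have h'' : |l| / (d + 1) * (d / 2) < |l| := by
    rw [div_mul_eq_mul_div, div_lt_iff₀ (by positivity)]
    nlinarith
  linarith

end Copositivity

theorem exists_forall_abs_apply_le {n : ℕ} (a : Matrix (Fin n) (Fin n) ℝ) :
    ∃ M : ℝ, ∀ i j, |a i j| ≤ M := by
  obtain ⟨M, hM⟩ := (Set.finite_range fun p : Fin n × Fin n => |a p.1 p.2|).bddAbove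
  exact ⟨M, fun i j => hM ⟨(i, j), rfl⟩⟩

/-- The copositive cone spans the symmetric matrices. -/
theorem surjective_of_image_Cn {n : ℕ} {φ : Sn n →ₗ[ℝ] Sn n} (hφ : φ '' Cn n = Cn n) :
    Function.Surjective φ := by
  intro b
  obtain ⟨M, hM⟩ := exists_forall_abs_apply_le b.1
  let J : Sn n := ⟨Matrix.of fun _ _ => |M|, by ext; rfl⟩
  have h1 : J ∈ Cn n := copositive_of_nonneg fun i j => abs_nonneg M
  have h2 : b + J ∈ Cn n := copositive_of_nonneg fun i j => by
    have := (abs_le.1 ((hM i j).trans (le_abs_self M))).1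
    change 0 ≤ b.1 i j + |M|
    linarith
  rw [← hφ] at h1 h2
  obtain ⟨x, -, hx⟩ := h1
  obtain ⟨y, -, hy⟩ := h2
  exact ⟨y - x, by rw [map_sub, hx, hy]; abel⟩

theorem mem_Cn_of_map_mem {n : ℕ} {φ : Sn n →ₗ[ℝ] Sn n} (hφ : φ '' Cn n = Cn n) {x : Sn n}
    (hx : φ x ∈ Cn n) : x ∈ Cn n := by
  have hinj : Function.Injective φ :=
    LinearMap.injective_iff_surjective.2 (surjective_of_image_Cn hφ)
  rw [← hφ] at hx
  exact (hinj.mem_set_image).1 hx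

/-- The `i`-th diagonal entry of `φ x` vanishes as soon as the diagonal of `x` does. -/
theorem map_diag_eq_zero {n : ℕ} {φ : Sn n →ₗ[ℝ] Sn n} (hφ : φ '' Cn n = Cn n) {a : Sn n}
    (ha : ∀ t, a.1 t t = 0) (i : Fin n) : (φ a).1 i i = 0 := by
  let B : Sn n := ⟨Matrix.of fun j k => if j = i ∧ k = i then 0 else 1, by
    ext j k; simp [and_comm]⟩
  have hBapp : ∀ j k, B.1 j k = if j = i ∧ k = i then 0 else 1 := fun _ _ => rfl
  have hB : B ∈ Cn n := copositive_of_nonneg fun j k => by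
    rw [hBapp]; split_ifs <;> norm_num
  rw [← hφ] at hB
  obtain ⟨A, hA, hAB⟩ := hB
  have hzero : ∃ u : Fin n → ℝ, (∀ k, 0 ≤ u k) ∧ u ≠ 0 ∧ u ⬝ᵥ A.1 *ᵥ u = 0 := by
    by_contra! hcon
    obtain ⟨X, hX⟩ := surjective_of_image_Cn hφ ⟨1, Matrix.isSymm_one⟩
    obtain ⟨ε, hε, hcop⟩ := exists_copositive_sub_smul
      (fun u hu hu0 => lt_of_le_of_ne (hA u hu) (hcon u hu hu0).symm) X.1
    have hmem : φ (A - ε • X) ∈ Cn n := hφ ▸ Set.mem_image_of_mem φ hcop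
    have hd : 0 ≤ (φ (A - ε • X)).1 i i := Copositive.diag_nonneg hmem i
    rw [map_sub, map_smul, hAB, hX] at hd
    change 0 ≤ B.1 i i - ε * (1 : Matrix (Fin n) (Fin n) ℝ) i i at hd
    simp [hBapp] at hd
    linarith
  obtain ⟨u, hu, hu0, hAu⟩ := hzero
  have hface : ∀ X : Sn n, (φ X).1 i i = 0 → ∃ M : ℝ, M • A + X ∈ Cn n := by
    intro X hX
    obtain ⟨M, hM⟩ := exists_forall_abs_apply_le (φ X).1
    refine ⟨M, mem_Cn_of_map_mem hφ (copositive_of_nonneg fun j k => ?_)⟩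
    rw [map_add, map_smul, hAB]
    change 0 ≤ M * B.1 j k + (φ X).1 j k
    rw [hBapp]
    split_ifs with h
    · rw [h.1, h.2, hX]; simp
    · linarith [(abs_le.1 (hM j k)).1]
  have hq : ∀ X : Sn n, (φ X).1 i i = 0 → u ⬝ᵥ X.1 *ᵥ u = 0 := by
    have hle : ∀ X : Sn n, (φ X).1 i i = 0 → 0 ≤ u ⬝ᵥ X.1 *ᵥ u := by
      intro X hX
      obtain ⟨M, hM⟩ := hface X hX
      have h := hM u hu
      change 0 ≤ u ⬝ᵥ (M • A.1 + X.1) *ᵥ u at h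
      simpa [add_mulVec, smul_mulVec, hAu] using h
    intro X hX
    have h := hle (-X) (by rw [map_neg]; change -(φ X).1 i i = 0; rw [hX, neg_zero])
    change 0 ≤ u ⬝ᵥ (-X.1) *ᵥ u at h
    rw [neg_mulVec, dotProduct_neg] at h
    linarith [hle X hX]
  have hl : ∀ X : Sn n, (φ X).1 i i = 0 → ∀ j, 0 < u j → (X.1 *ᵥ u) j = 0 := by
    intro X hX j hj
    obtain ⟨M, hM⟩ := hface X hX
    have h := Copositive.mulVec_apply_eq_zero hM (M • A + X).2 hu (by
      change u ⬝ᵥ (M • A.1 + X.1) *ᵥ u = 0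
      simp [add_mulVec, smul_mulVec, hAu, hq X hX]) hj
    have h' : (A.1 *ᵥ u) j = 0 := Copositive.mulVec_apply_eq_zero hA A.2 hu hAu hj
    change ((M • A.1 + X.1) *ᵥ u) j = 0 at h
    simpa [add_mulVec, smul_mulVec, h'] using h
  have hconv : ∀ X : Sn n, u ⬝ᵥ X.1 *ᵥ u = 0 → (φ X).1 i i = 0 := by
    intro X hX
    let I : Sn n := ⟨1, Matrix.isSymm_one⟩
    have h := hq ((φ I).1 i i • X - (φ X).1 i i • I) (by
      rw [map_sub, map_smul, map_smul]
      change (φ I).1 i i * (φ X).1 i i - (φ X).1 i i * (φ I).1 i i = 0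
      ring)
    change u ⬝ᵥ ((φ I).1 i i • X.1 - (φ X).1 i i • (1 : Matrix (Fin n) (Fin n) ℝ)) *ᵥ u = 0 at h
    simpa [sub_mulVec, smul_mulVec, hX, hu0, dotProduct_self_eq_zero] using h
  obtain ⟨j, hj⟩ := Function.ne_iff.1 hu0
  have hj : 0 < u j := lt_of_le_of_ne (hu j) (Ne.symm hj)
  have hsupp : ∀ k, k ≠ j → u k = 0 := by
    intro k hkj
    by_contra hk
    let D : Sn n := ⟨diagonal (Pi.single j (u k ^ 2) - Pi.single k (u j ^ 2)),
      isSymm_diagonal _⟩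
    have hD : ∀ l, (D.1 *ᵥ u) l =
        ((Pi.single j (u k ^ 2) : Fin n → ℝ) l - (Pi.single k (u j ^ 2) : Fin n → ℝ) l) * u l :=
      fun l => mulVec_diagonal _ _ l
    have h := hl D (hconv D (by
      simp only [dotProduct, hD, sub_mul, mul_sub, Finset.sum_sub_distrib, Pi.single_apply]
      simp
      ring)) j hj
    rw [hD] at h
    simp [hkj.symm, hk, hj.ne'] at h
  have hus : u = Pi.single j (u j) := by
    ext k
    by_cases hk : k = j
    · subst hk; simp
    · simp [hk, hsupp k hk]
  refine hconv a ?_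
  rw [hus]
  simp [mulVec_single, ha]

/-- φ maps T_n into itself. -/
theorem stmt_15 (n : ℕ) (φ : Sn n →ₗ[ℝ] Sn n) (hφ : φ '' Cn n = Cn n) :
    φ '' Tn n ⊆ Tn n := by
  rintro _ ⟨a, ha, rfl⟩
  have hmem : φ a ∈ Cn n := hφ ▸ Set.mem_image_of_mem φ (copositive_of_nonneg ha.1)
  have hd := map_diag_eq_zero hφ ha.2
  exact ⟨Copositive.apply_nonneg hmem (φ a).2 hd, hd⟩
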